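/- Let X be a real Banach space, p ∈ (1,∞), μ ∈ (1/p,1], r ∈ (0,1), ω ∈ ℝ. Then there exists a constant C = C(p,r,ω) > 0, independent of T ∈ (0,∞), such that for every strongly measurable u : (0,T) → X: (∬_{B_T^1} s^{(1-μ)p} e^{ωps} ‖u(t)-u(s)‖_X^p (t-s)^{-1-rp} ds dt)^{1/p} ≤ C [ (∫_0^T t^{(1-μ)p} e^{ωpt} ‖u(t)‖_X^p dt)^{1/p} + (∫_0^T ∫_0^t s^{(1-μ)p} ‖e^{ωt} u(t) - e^{ωs} u(s)‖_X^p (t-s)^{-1-rp} ds dt)^{1/p} ], where B_T^1 = {(s,t) : 0 < s < t < T, t - s < 1}. -/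

import Mathlib

open MeasureTheory Set ENNReal Real

lemma aux_exp (ω h : ℝ) (h0 : 0 < h) (h1 : h < 1) :
    |Real.exp (-(ω * h)) - 1| ≤ |ω| * Real.exp |ω| * h := by
  have key : ∀ x : ℝ, |Real.exp x - 1| ≤ |x| * Real.exp |x| := by
    intro x
    have e1 := Real.add_one_le_exp x
    have e2 := Real.add_one_le_exp (-x)
    have e4 : Real.exp x * Real.exp (-x) = 1 := by rw [← Real.exp_add]; simp
    have e5 := Real.exp_pos x
    have e6 : Real.exp x - 1 ≤ x * Real.exp x := by nlinarith
    rcases le_total 0 x with hx | hx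
    · rw [abs_of_nonneg hx, abs_of_nonneg (by linarith)]
      exact e6
    · rw [abs_of_nonpos hx, abs_of_nonpos (by nlinarith)]
      have := Real.add_one_le_exp (-x)
      nlinarith
  refine (key _).trans ?_
  have : |-(ω * h)| = |ω| * h := by rw [abs_neg, abs_mul, abs_of_pos h0]
  rw [this]
  have h2 : |ω| * h ≤ |ω| := by nlinarith [abs_nonneg ω]
  have := Real.exp_le_exp.mpr h2
  have h3 : 0 ≤ |ω| * h := by positivity
  nlinarith

lemma aux_pt {X : Type*} [NormedAddCommGroup X] [NormedSpace ℝ X]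
    (p a r ω : ℝ) (hp : 1 < p) (ha : 0 ≤ a) (u : ℝ → X) (s t : ℝ)
    (hs : 0 < s) (hst : s < t) (h1 : t - s < 1) :
    s ^ a * Real.exp (ω * p * s) * ‖u t - u s‖ ^ p / (t - s) ^ (1 + r * p) ≤
      (2 ^ p * (|ω| * Real.exp |ω|) ^ p) * (t ^ a * Real.exp (ω * p * t) * ‖u t‖ ^ p)
          * (t - s) ^ (p * (1 - r) - 1)
        + 2 ^ p * (s ^ a * ‖Real.exp (ω * t) • u t - Real.exp (ω * s) • u s‖ ^ p
            / (t - s) ^ (1 + r * p)) := by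
  have h0 : 0 < t - s := by linarith
  have hp0 : 0 < p := by linarith
  have ht : 0 < t := by linarith
  set K := |ω| * Real.exp |ω| with hK
  have hK0 : 0 ≤ K := by positivity
  have e : ∀ x : ℝ, Real.exp (ω * p * x) = Real.exp (ω * x) ^ p := by
    intro x; rw [← Real.exp_mul]; ring_nf
  rw [e, e]
  set N := ‖Real.exp (ω * t) • u t - Real.exp (ω * s) • u s‖ with hN
  have hN0 : 0 ≤ N := norm_nonneg _
  have b1 : Real.exp (ω * s) * ‖u t - u s‖ ≤ K * (t - s) * (Real.exp (ω * t) * ‖u t‖) + N := by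
    have q : Real.exp (ω * s) • (u t - u s) =
        (Real.exp (-(ω * (t - s))) - 1) • (Real.exp (ω * t) • u t)
          + (Real.exp (ω * t) • u t - Real.exp (ω * s) • u s) := by
      rw [sub_smul, smul_smul, ← Real.exp_add, smul_sub, one_smul]
      have : -(ω * (t - s)) + ω * t = ω * s := by ring
      rw [this]; abel
    have q2 : Real.exp (ω * s) * ‖u t - u s‖ = ‖Real.exp (ω * s) • (u t - u s)‖ := by
      rw [norm_smul, Real.norm_of_nonneg (Real.exp_pos _).le]
    rw [q2, q]
    refine (norm_add_le _ _).trans ?_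
    gcongr
    rw [norm_smul, norm_smul, Real.norm_of_nonneg (Real.exp_pos _).le, Real.norm_eq_abs]
    gcongr
    exact aux_exp ω _ h0 h1
  set A := K * (t - s) * (Real.exp (ω * t) * ‖u t‖) with hA
  have hA0 : 0 ≤ A := by positivity
  have b2 : (A + N) ^ p ≤ 2 ^ p * (A ^ p + N ^ p) := by
    have : A + N ≤ 2 * max A N := by
      have := le_max_left A N
      have := le_max_right A N
      linarith
    calc (A + N) ^ p ≤ (2 * max A N) ^ p := by gcongr
      _ = 2 ^ p * (max A N) ^ p := by rw [Real.mul_rpow (by norm_num) (by positivity)]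
      _ ≤ _ := by
        gcongr
        rcases le_total A N with h | h
        · rw [max_eq_right h]; linarith [Real.rpow_nonneg hA0 p]
        · rw [max_eq_left h]; linarith [Real.rpow_nonneg hN0 p]
  have b3 : Real.exp (ω * s) ^ p * ‖u t - u s‖ ^ p ≤ 2 ^ p * (A ^ p + N ^ p) := by
    rw [← Real.mul_rpow (by positivity) (by positivity)]
    exact (Real.rpow_le_rpow (by positivity) b1 hp0.le).trans b2
  have b4 : A ^ p = K ^ p * (t - s) ^ p * (Real.exp (ω * t) ^ p * ‖u t‖ ^ p) := by
    have m1 : 0 ≤ K * (t - s) := by positivity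
    have m2 : 0 ≤ Real.exp (ω * t) * ‖u t‖ := by positivity
    rw [hA, Real.mul_rpow m1 m2, Real.mul_rpow hK0 h0.le,
      Real.mul_rpow (Real.exp_pos _).le (norm_nonneg _)]
  have b5 : (t - s) ^ (p * (1 - r) - 1) = (t - s) ^ p / (t - s) ^ (1 + r * p) := by
    rw [← Real.rpow_sub h0]; ring_nf
  have b6 : s ^ a ≤ t ^ a := by gcongr
  calc s ^ a * Real.exp (ω * s) ^ p * ‖u t - u s‖ ^ p / (t - s) ^ (1 + r * p)
      = s ^ a * (Real.exp (ω * s) ^ p * ‖u t - u s‖ ^ p) / (t - s) ^ (1 + r * p) := by ring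
    _ ≤ s ^ a * (2 ^ p * (A ^ p + N ^ p)) / (t - s) ^ (1 + r * p) := by gcongr
    _ = 2 ^ p * (s ^ a * A ^ p / (t - s) ^ (1 + r * p))
        + 2 ^ p * (s ^ a * N ^ p / (t - s) ^ (1 + r * p)) := by ring
    _ ≤ 2 ^ p * (t ^ a * A ^ p / (t - s) ^ (1 + r * p))
        + 2 ^ p * (s ^ a * N ^ p / (t - s) ^ (1 + r * p)) := by gcongr
    _ = _ := by rw [b4, b5]; ring

lemma aux_int (b : ℝ) (t : ℝ) :
    ∫⁻ s in Ioo (max (t - 1) 0) t, ENNReal.ofReal ((t - s) ^ b) ≤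
      ∫⁻ x in Ioo (0 : ℝ) 1, ENNReal.ofReal (x ^ b) := by
  rw [← lintegral_indicator measurableSet_Ioo, ← lintegral_indicator measurableSet_Ioo,
    ← lintegral_sub_left_eq_self
      ((Ioo (0 : ℝ) 1).indicator fun x => ENNReal.ofReal (x ^ b)) t]
  refine lintegral_mono fun s => ?_
  by_cases hs : s ∈ Ioo (max (t - 1) 0) t
  · have h2 : t - s ∈ Ioo (0 : ℝ) 1 := by
      have := le_max_left (t - 1) 0
      have := hs.1
      have := hs.2
      constructor <;> linarith
    rw [indicator_of_mem hs, indicator_of_mem h2]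
  · simp [indicator_of_notMem hs]

lemma aux_fin (b : ℝ) (hb : -1 < b) :
    ∫⁻ x in Ioo (0 : ℝ) 1, ENNReal.ofReal (x ^ b) ≠ ⊤ := by
  have h : IntegrableOn (fun x : ℝ => x ^ b) (Ioo 0 1) :=
    (intervalIntegral.integrableOn_Ioo_rpow_iff one_pos).2 hb
  exact h.lintegral_lt_top.ne

/-- Lemma A.5 of the paper, second inequality: for `p ∈ (1,∞)`, `μ ∈ (1/p,1]`,
`r ∈ (0,1)`, `ω ∈ ℝ`, there is `C = C(p,r,ω) > 0` independent of `T ∈ (0,∞)` such that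
the exponentially weighted seminorm restricted to `B_T^1 = {(s,t) : 0 < s < t < T, t-s < 1}`
is bounded by `C` times the intrinsic weighted norm of the reweighted function
`e_ω u : t ↦ e^{ωt} u(t)`. -/
theorem stmt_7 {X : Type*} [NormedAddCommGroup X] [NormedSpace ℝ X] [CompleteSpace X]
    (p μ r ω : ℝ) (hp : 1 < p) (hμ : 1 / p < μ) (hμ1 : μ ≤ 1)
    (hr0 : 0 < r) (hr1 : r < 1) :
    ∃ C : ℝ, 0 < C ∧
      ∀ T : ℝ, 0 < T →
        ∀ u : ℝ → X, StronglyMeasurable u →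
          (∫⁻ t in Ioo (0 : ℝ) T,
              ∫⁻ s in Ioo (max (t - 1) 0) t,
                ENNReal.ofReal
                  (s ^ ((1 - μ) * p) * Real.exp (ω * p * s) * ‖u t - u s‖ ^ p
                    / (t - s) ^ (1 + r * p))) ^ (1 / p)
            ≤ ENNReal.ofReal C *
                ((∫⁻ t in Ioo (0 : ℝ) T,
                    ENNReal.ofReal
                      (t ^ ((1 - μ) * p) * Real.exp (ω * p * t) * ‖u t‖ ^ p)) ^ (1 / p)
                 + (∫⁻ t in Ioo (0 : ℝ) T,
                      ∫⁻ s in Ioo (0 : ℝ) t,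
                        ENNReal.ofReal
                          (s ^ ((1 - μ) * p)
                            * ‖Real.exp (ω * t) • u t - Real.exp (ω * s) • u s‖ ^ p
                            / (t - s) ^ (1 + r * p))) ^ (1 / p)) := by
  have hp0 : 0 < p := by linarith
  have ha : 0 ≤ (1 - μ) * p := mul_nonneg (by linarith) hp0.le
  set a := (1 - μ) * p
  set b := p * (1 - r) - 1 with hb
  have hb1 : -1 < b := by
    have : 0 < p * (1 - r) := mul_pos hp0 (by linarith)
    linarith
  set J := ∫⁻ x in Ioo (0 : ℝ) 1, ENNReal.ofReal (x ^ b) with hJ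
  have hJf : J ≠ ⊤ := aux_fin b hb1
  set c1 : ℝ := 2 ^ p * (|ω| * Real.exp |ω|) ^ p with hc1
  have hc10 : 0 ≤ c1 := by positivity
  have h2p : (0 : ℝ) < 2 ^ p := by positivity
  set M : ℝ := c1 * J.toReal + 2 ^ p with hM
  have hM0 : 0 < M := by positivity
  refine ⟨M ^ (1 / p), by positivity, ?_⟩
  intro T hT u hu
  set A := ∫⁻ t in Ioo (0 : ℝ) T,
    ENNReal.ofReal (t ^ a * Real.exp (ω * p * t) * ‖u t‖ ^ p) with hA
  set B := ∫⁻ t in Ioo (0 : ℝ) T, ∫⁻ s in Ioo (0 : ℝ) t,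
    ENNReal.ofReal (s ^ a * ‖Real.exp (ω * t) • u t - Real.exp (ω * s) • u s‖ ^ p
      / (t - s) ^ (1 + r * p)) with hB
  have hun : Measurable fun t => ‖u t‖ := hu.norm.measurable
  have main : (∫⁻ t in Ioo (0 : ℝ) T, ∫⁻ s in Ioo (max (t - 1) 0) t,
      ENNReal.ofReal (s ^ a * Real.exp (ω * p * s) * ‖u t - u s‖ ^ p
        / (t - s) ^ (1 + r * p))) ≤ ENNReal.ofReal M * (A + B) := by
    have inner : ∀ t ∈ Ioo (0 : ℝ) T, (∫⁻ s in Ioo (max (t - 1) 0) t,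
        ENNReal.ofReal (s ^ a * Real.exp (ω * p * s) * ‖u t - u s‖ ^ p
          / (t - s) ^ (1 + r * p))) ≤
        ENNReal.ofReal (c1 * J.toReal)
          * ENNReal.ofReal (t ^ a * Real.exp (ω * p * t) * ‖u t‖ ^ p)
        + ENNReal.ofReal (2 ^ p) * ∫⁻ s in Ioo (0 : ℝ) t,
          ENNReal.ofReal (s ^ a * ‖Real.exp (ω * t) • u t - Real.exp (ω * s) • u s‖ ^ p
            / (t - s) ^ (1 + r * p)) := by
      intro t ht
      have ht0 : 0 < t := ht.1
      set g := t ^ a * Real.exp (ω * p * t) * ‖u t‖ ^ p with hg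
      have hg0 : 0 ≤ g := by positivity
      calc _ ≤ ∫⁻ s in Ioo (max (t - 1) 0) t,
            (ENNReal.ofReal (c1 * g) * ENNReal.ofReal ((t - s) ^ b)
            + ENNReal.ofReal (2 ^ p) * ENNReal.ofReal
              (s ^ a * ‖Real.exp (ω * t) • u t - Real.exp (ω * s) • u s‖ ^ p
              / (t - s) ^ (1 + r * p))) := by
            refine setLIntegral_mono' measurableSet_Ioo fun s hs => ?_
            have k1 := le_max_left (t - 1) 0
            have k2 := le_max_right (t - 1) 0
            have k3 := hs.1
            have k4 := hs.2
            have hs0 : 0 < s := by linarith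
            have hts : 0 < t - s := by linarith
            rw [← ENNReal.ofReal_mul (by positivity), ← ENNReal.ofReal_mul (by positivity),
              ← ENNReal.ofReal_add (by positivity) (by positivity)]
            exact ENNReal.ofReal_le_ofReal
              (aux_pt p a r ω hp ha u s t hs0 k4 (by linarith))
        _ = ENNReal.ofReal (c1 * g) * (∫⁻ s in Ioo (max (t - 1) 0) t,
              ENNReal.ofReal ((t - s) ^ b))
            + ENNReal.ofReal (2 ^ p) * ∫⁻ s in Ioo (max (t - 1) 0) t, ENNReal.ofReal
              (s ^ a * ‖Real.exp (ω * t) • u t - Real.exp (ω * s) • u s‖ ^ p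
              / (t - s) ^ (1 + r * p)) := by
            rw [lintegral_add_left (by fun_prop), lintegral_const_mul' _ _ ofReal_ne_top,
              lintegral_const_mul' _ _ ofReal_ne_top]
        _ ≤ _ := by
            have e1 : ENNReal.ofReal (c1 * J.toReal) * ENNReal.ofReal g
                = ENNReal.ofReal (c1 * g) * J := by
              rw [ENNReal.ofReal_mul hc10, ENNReal.ofReal_mul hc10, ENNReal.ofReal_toReal hJf]
              ring
            rw [e1]
            gcongr
            · exact aux_int b t
            · exact le_max_right _ _
    calc _ ≤ _ := setLIntegral_mono' measurableSet_Ioo inner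
      _ = ENNReal.ofReal (c1 * J.toReal) * A + ENNReal.ofReal (2 ^ p) * B := by
        rw [lintegral_add_left (by fun_prop), lintegral_const_mul' _ _ ofReal_ne_top,
              lintegral_const_mul' _ _ ofReal_ne_top]
      _ ≤ ENNReal.ofReal M * A + ENNReal.ofReal M * B := by
        have : 0 ≤ c1 * J.toReal := by positivity
        gcongr <;> linarith
      _ = _ := by ring
  have hq : 0 ≤ 1 / p := by positivity
  calc _ ≤ (ENNReal.ofReal M * (A + B)) ^ (1 / p) := ENNReal.rpow_le_rpow main hq
    _ = ENNReal.ofReal (M ^ (1 / p)) * (A + B) ^ (1 / p) := by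
      rw [ENNReal.mul_rpow_of_nonneg _ _ hq, ENNReal.ofReal_rpow_of_pos hM0]
    _ ≤ _ := by
      gcongr
      exact ENNReal.rpow_add_le_add_rpow _ _ hq (by rw [div_le_one hp0]; exact hp.le)
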